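/- arXiv:1002.4907 — 7 statements merged into one kernel-verified Lean document; each statement's English description precedes it below -/
import Mathlib

section
/- (Gallager's Redundancy Bound) Let n ≥ 1 and let p : Fin n → ℝ be a probability vector with largest probability p₁ = max over i of p i. Then L_H(p) − H(p) ≤ p₁ + σ, where σ = 1 − log₂ e + log₂(log₂ e) ≈ 0.086. -/
/-- A probability vector on `Fin n`: nonnegative entries summing to 1. -/
def IsProbVec {n : ℕ} (p : Fin n → ℝ) : Prop :=
  (∀ i, 0 ≤ p i) ∧ ∑ i, p i = 1

/-- A prefix-free binary code: an injective assignment of codewords such that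
no codeword is a prefix of another. -/
def IsPrefixFreeCode {n : ℕ} (c : Fin n → List Bool) : Prop :=
  Function.Injective c ∧ ∀ i j : Fin n, i ≠ j → ¬ (c i <+: c j)

/-- A terminating-yes code: every codeword is nonempty and ends with `true`. -/
def IsTermYes {n : ℕ} (c : Fin n → List Bool) : Prop :=
  ∀ i, c i ≠ [] ∧ (c i).getLast? = some true

/-- Average codeword length of the code `c` under the probability vector `p`. -/
noncomputable def avgLen {n : ℕ} (p : Fin n → ℝ) (c : Fin n → List Bool) : ℝ :=
  ∑ i, p i * ((c i).length : ℝ)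

/-- `L_H(p)`: infimum of average lengths over all prefix-free binary codes. -/
noncomputable def LH {n : ℕ} (p : Fin n → ℝ) : ℝ :=
  sInf {L : ℝ | ∃ c : Fin n → List Bool, IsPrefixFreeCode c ∧ avgLen p c = L}

/-- `L_yes(p)`: infimum of average lengths over all prefix-free terminating-yes codes. -/
noncomputable def Lyes {n : ℕ} (p : Fin n → ℝ) : ℝ :=
  sInf {L : ℝ | ∃ c : Fin n → List Bool,
    IsPrefixFreeCode c ∧ IsTermYes c ∧ avgLen p c = L}

/-- Shannon entropy in bits, with the convention `0 * log₂ 0 = 0`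
(automatic since `Real.logb 2 0 = 0`). -/
noncomputable def entropy {n : ℕ} (p : Fin n → ℝ) : ℝ :=
  -∑ i, p i * Real.logb 2 (p i)

/-- Gallager's constant `σ = 1 - log₂ e + log₂ (log₂ e) ≈ 0.086`. -/
noncomputable def gallagerSigma : ℝ :=
  1 - Real.logb 2 (Real.exp 1) + Real.logb 2 (Real.logb 2 (Real.exp 1))

/-- Two words are incomparable when neither is a prefix of the other. -/
def Incomparable (u v : List Bool) : Prop := ¬ u <+: v ∧ ¬ v <+: u

theorem Incomparable.symm {u v : List Bool} (h : Incomparable u v) : Incomparable v u :=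
  ⟨h.2, h.1⟩

theorem Incomparable.append_singleton {u v : List Bool} (h : Incomparable u v) (x : Bool) :
    Incomparable (u ++ [x]) v := by
  refine ⟨fun h' => h.1 ((List.prefix_append u [x]).trans h'), fun h' => ?_⟩
  rcases List.prefix_concat_iff.1 h' with h' | h'
  · exact h.1 (h' ▸ List.prefix_append u [x])
  · exact h.2 h'

theorem Incomparable.cons {u v : List Bool} (h : Incomparable u v) (x : Bool) :
    Incomparable (x :: u) (x :: v) := by
  simpa [Incomparable, List.cons_prefix_cons] using h

/-- The weights in `S` can be assigned to pairwise incomparable binary words with total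
weighted length `L`. -/
def HasCodeCost (S : Multiset ℝ) (L : ℝ) : Prop :=
  ∃ T : List (List Bool × ℝ), (T.map Prod.snd : Multiset ℝ) = S ∧
    T.Pairwise (fun s t => Incomparable s.1 t.1) ∧
    (T.map fun t => t.2 * (t.1.length : ℝ)).sum = L

theorem hasCodeCost_singleton (x : ℝ) : HasCodeCost {x} 0 :=
  ⟨[([], x)], by simp, by simp, by simp⟩

theorem HasCodeCost.split {a b L : ℝ} {S : Multiset ℝ} (h : HasCodeCost ((a + b) ::ₘ S) L) :
    HasCodeCost (b ::ₘ a ::ₘ S) (L + (a + b)) := by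
  obtain ⟨T, hT, hpw, hL⟩ := h
  have hmem : a + b ∈ T.map Prod.snd := by
    rw [← Multiset.mem_coe, hT]; exact Multiset.mem_cons_self _ _
  obtain ⟨⟨w, y⟩, ht, hy⟩ := List.mem_map.1 hmem
  obtain rfl : y = a + b := hy
  have hperm := List.perm_cons_erase ht
  set T' := T.erase (w, a + b)
  have hpw' := (hperm.pairwise_iff (fun h => Incomparable.symm h)).1 hpw
  rw [List.pairwise_cons] at hpw'
  rw [Multiset.coe_eq_coe.2 (hperm.map Prod.snd), List.map_cons, ← Multiset.cons_coe,
    Multiset.cons_inj_right] at hT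
  rw [(hperm.map _).sum_eq, List.map_cons, List.sum_cons] at hL
  refine ⟨(w ++ [false], b) :: (w ++ [true], a) :: T', ?_, ?_, ?_⟩
  · simp [← hT]
  · simp only [List.pairwise_cons, List.mem_cons, forall_eq_or_imp]
    refine ⟨⟨?_, fun t ht => (hpw'.1 t ht).append_singleton _⟩,
      fun t ht => (hpw'.1 t ht).append_singleton _, hpw'.2⟩
    simp [Incomparable, List.prefix_append_right_inj]
  · simp only [List.map_cons, List.sum_cons, List.length_append, List.length_singleton,
      Nat.cast_add, Nat.cast_one, ← hL]
    ring

theorem HasCodeCost.add {S₁ S₂ : Multiset ℝ} {L₁ L₂ : ℝ} (h₁ : HasCodeCost S₁ L₁)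
    (h₂ : HasCodeCost S₂ L₂) : HasCodeCost (S₁ + S₂) (L₁ + L₂ + (S₁ + S₂).sum) := by
  obtain ⟨T₁, rfl, hp₁, rfl⟩ := h₁
  obtain ⟨T₂, rfl, hp₂, rfl⟩ := h₂
  refine ⟨T₁.map (fun t => (false :: t.1, t.2)) ++ T₂.map (fun t => (true :: t.1, t.2)),
    ?_, ?_, ?_⟩
  · simp [Function.comp_def]
  · rw [List.pairwise_append, List.pairwise_map, List.pairwise_map]
    refine ⟨hp₁.imp fun h => h.cons _, hp₂.imp fun h => h.cons _, ?_⟩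
    simp only [List.mem_map]
    rintro _ ⟨s, -, rfl⟩ _ ⟨t, -, rfl⟩
    simp [Incomparable, List.cons_prefix_cons]
  · simp only [List.map_append, List.map_map, List.sum_append, Function.comp_def,
      List.length_cons, Nat.cast_add, Nat.cast_one, mul_add, mul_one, List.sum_map_add,
      Multiset.sum_add, Multiset.sum_coe]
    ring

theorem hasCodeCost_of_card_eq_two_pow (l : ℕ) :
    ∀ S : Multiset ℝ, S.card = 2 ^ l → HasCodeCost S (l * S.sum) := by
  induction l with
  | zero =>
    intro S hS
    obtain ⟨x, rfl⟩ := Multiset.card_eq_one.1 (by simpa using hS)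
    simpa using hasCodeCost_singleton x
  | succ l ih =>
    intro S hS
    obtain ⟨S₁, S₂, rfl, h₁, h₂⟩ :
        ∃ S₁ S₂ : Multiset ℝ, S = S₁ + S₂ ∧ S₁.card = 2 ^ l ∧ S₂.card = 2 ^ l := by
      induction S using Quotient.inductionOn with | _ T
      rw [pow_succ] at hS
      replace hS : T.length = 2 ^ l * 2 := hS
      refine ⟨T.take (2 ^ l), T.drop (2 ^ l), ?_, ?_, ?_⟩
      · rw [Multiset.coe_add, List.take_append_drop]
        rfl
      · rw [Multiset.coe_card, List.length_take]
        omega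
      · rw [Multiset.coe_card, List.length_drop]
        omega
    convert (ih S₁ h₁).add (ih S₂ h₂) using 1
    push_cast
    rw [Multiset.sum_add]
    ring

theorem LH_le_of_hasCodeCost {n : ℕ} {p : Fin n → ℝ} (hp : ∀ i, 0 ≤ p i) {L : ℝ}
    (h : HasCodeCost (Finset.univ.val.map p) L) : LH p ≤ L := by
  obtain ⟨T, hT, hpw, hL⟩ := h
  have hperm : (List.ofFn p).Perm (T.map Prod.snd) := by
    rw [← Multiset.coe_eq_coe, hT, Fin.univ_val_map]
  have hrel : List.Forall₂ (fun x (t : List Bool × ℝ) => x = t.2) (T.map Prod.snd) T := by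
    rw [List.forall₂_map_left_iff, List.forall₂_same]
    simp
  obtain ⟨T', hT', hTT'⟩ := List.perm_comp_forall₂ hperm hrel
  have hlen : T'.length = n := by simpa using hT'.length_eq.symm
  subst hlen
  have hval : ∀ i : Fin T'.length, p i = (T'.get i).2 := fun i => by
    simpa using hT'.get (i := i) (by simp) i.2
  have hpw' := (hTT'.pairwise_iff (fun h => Incomparable.symm h)).2 hpw
  have hinc : ∀ i j : Fin T'.length, i ≠ j → Incomparable (T'.get i).1 (T'.get j).1 := by
    intro i j hij
    rcases lt_or_gt_of_ne hij with hlt | hlt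
    · exact List.pairwise_iff_get.1 hpw' i j hlt
    · exact (List.pairwise_iff_get.1 hpw' j i hlt).symm
  refine csInf_le ⟨0, ?_⟩ ⟨fun i => (T'.get i).1, ⟨fun i j hij => ?_, fun i j hij => ?_⟩, ?_⟩
  · rintro _ ⟨c, -, rfl⟩
    exact Finset.sum_nonneg fun i _ => mul_nonneg (hp i) (Nat.cast_nonneg _)
  · by_contra hne
    have := (hinc i j hne).1
    simp only at hij
    exact this (hij ▸ List.prefix_refl _)
  · exact (hinc i j hij).1
  · rw [← hL, ← (hTT'.map _).sum_eq, avgLen, ← Fin.sum_univ_fun_getElem]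
    exact Finset.sum_congr rfl fun i _ => by simp [hval]

theorem le_logb_two_one_add {x : ℝ} (h₀ : 0 ≤ x) (h₁ : x ≤ 1) : x ≤ Real.logb 2 (1 + x) := by
  rw [Real.le_logb_iff_rpow_le one_lt_two (by linarith)]
  have := rpow_one_add_le_one_add_mul_self (s := 1) (by norm_num) h₀ h₁
  norm_num at this
  exact this

/-- Merging two weights costs at most their difference in redundancy. -/
theorem merge_redundancy_le {a b : ℝ} (hb : 0 ≤ b) (hba : b ≤ a) :
    (a + b) + a * Real.logb 2 a + b * Real.logb 2 b - (a + b) * Real.logb 2 (a + b) ≤ a - b := by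
  rcases hb.eq_or_lt with rfl | hb
  · simp
  have ha : 0 < a := hb.trans_le hba
  have e : Real.logb 2 (a + b) = Real.logb 2 a + Real.logb 2 (1 + b / a) := by
    rw [← Real.logb_mul ha.ne' (by positivity)]
    congr 1
    field_simp
  have h₁ : b / a ≤ Real.logb 2 (1 + b / a) :=
    le_logb_two_one_add (by positivity) ((div_le_one ha).2 hba)
  have h₂ : a * (b / a) ≤ a * Real.logb 2 (1 + b / a) := mul_le_mul_of_nonneg_left h₁ ha.le
  rw [mul_div_cancel₀ _ ha.ne'] at h₂
  have h₃ : 1 + Real.logb 2 b ≤ Real.logb 2 (a + b) := by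
    have : Real.logb 2 (2 * b) = 1 + Real.logb 2 b := by
      rw [Real.logb_mul two_ne_zero hb.ne', Real.logb_self_eq_one one_lt_two]
    rw [← this]
    exact Real.logb_le_logb_of_le one_lt_two (by positivity) (by linarith)
  have h₄ := mul_le_mul_of_nonneg_left h₃ hb.le
  have h₅ : a * Real.logb 2 (a + b) = a * Real.logb 2 a + a * Real.logb 2 (1 + b / a) := by
    rw [e]; ring
  linarith

/-- The chord bound for `x ↦ x * logb 2 x` on `[m, 2 * m]`. -/
theorem mul_logb_two_le_chord {m x : ℝ} (hm : 0 < m) (hmx : m ≤ x) (hxm : x ≤ 2 * m) :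
    x * Real.logb 2 x ≤ x * Real.logb 2 m + 2 * (x - m) := by
  have hx : 0 < x := hm.trans_le hmx
  have h := le_logb_two_one_add (x := 2 * m / x - 1)
    (by rw [sub_nonneg, one_le_div hx]; exact hxm)
    (by rw [sub_le_iff_le_add, div_le_iff₀ hx]; linarith)
  rw [add_sub_cancel, Real.logb_div (by positivity) hx.ne',
    Real.logb_mul two_ne_zero hm.ne', Real.logb_self_eq_one one_lt_two] at h
  have h' := mul_le_mul_of_nonneg_left h hx.le
  have e : x * (2 * m / x - 1) = 2 * m - x := by field_simp
  rw [e] at h'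
  linarith

theorem logb_two_add_le_gallagerSigma {u : ℝ} (hu : 0 < u) :
    Real.logb 2 u + 2 - 2 * u ≤ gallagerSigma := by
  have h2 : 0 < Real.log 2 := Real.log_pos one_lt_two
  have h := Real.log_le_sub_one_of_pos (x := 2 * u * Real.log 2) (by positivity)
  rw [Real.log_mul (by positivity) h2.ne', Real.log_mul two_ne_zero hu.ne'] at h
  unfold gallagerSigma
  simp only [Real.logb, Real.log_exp, one_div, Real.log_inv]
  have h' := div_le_div_of_nonneg_right h h2.le
  have e₁ : (Real.log 2 + Real.log u + Real.log (Real.log 2)) / Real.log 2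
      = 1 + Real.log u / Real.log 2 + Real.log (Real.log 2) / Real.log 2 := by
    field_simp
  have e₂ : (2 * u * Real.log 2 - 1) / Real.log 2 = 2 * u - (Real.log 2)⁻¹ := by
    field_simp
  rw [e₁, e₂] at h'
  rw [neg_div]
  linarith

theorem Multiset.exists_eq_cons_forall_le {α : Type*} [LinearOrder α] {S : Multiset α}
    (hS : S ≠ 0) : ∃ b S', S = b ::ₘ S' ∧ ∀ x ∈ S', b ≤ x := by
  obtain ⟨b, hb, hmin⟩ := S.toFinset.exists_min_image id
    (Multiset.toFinset_nonempty.2 hS)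
  rw [Multiset.mem_toFinset] at hb
  exact ⟨b, S.erase b, (Multiset.cons_erase hb).symm,
    fun x hx => hmin x (Multiset.mem_toFinset.2 (Multiset.mem_of_mem_erase hx))⟩

/-- A fixed-length code has redundancy at most `gallagerSigma` when the `2 ^ l` weights are
within a factor two of each other. -/
theorem card_two_pow_redundancy_le {S : Multiset ℝ} {l : ℕ} (hcard : S.card = 2 ^ l)
    (hsum : S.sum = 1) (hratio : ∀ x ∈ S, ∀ y ∈ S, x ≤ 2 * y) :
    l + (S.map fun x => x * Real.logb 2 x).sum ≤ gallagerSigma := by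
  have hS : S ≠ 0 := by rintro rfl; simp at hsum
  obtain ⟨m, S', rfl, hmin⟩ := Multiset.exists_eq_cons_forall_le hS
  have hle : ∀ x ∈ m ::ₘ S', m ≤ x := by simpa using hmin
  have hub : ∀ x ∈ m ::ₘ S', x ≤ 2 * m := fun x hx => hratio x hx m (by simp)
  have hm : 0 < m := by
    by_contra! hm
    have : (m ::ₘ S').sum ≤ (m ::ₘ S').card • 0 :=
      Multiset.sum_le_card_nsmul _ _ fun x hx => by linarith [hub x hx]
    rw [smul_zero] at this
    linarith
  generalize m ::ₘ S' = S at *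
  have hbound : (S.map fun x => x * Real.logb 2 x).sum
      ≤ (S.map fun x => x * Real.logb 2 m + 2 * (x - m)).sum :=
    Multiset.sum_map_le_sum_map _ _ fun x hx => mul_logb_two_le_chord hm (hle x hx) (hub x hx)
  have heq : (S.map fun x => x * Real.logb 2 m + 2 * (x - m)).sum
      = Real.logb 2 m + 2 * (1 - 2 ^ l * m) := by
    rw [Multiset.sum_map_add, Multiset.sum_map_mul_right, Multiset.sum_map_mul_left,
      Multiset.sum_map_sub, Multiset.map_const', Multiset.sum_replicate, Multiset.map_id', hsum,
      hcard]
    simp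
  have h := logb_two_add_le_gallagerSigma (u := 2 ^ l * m) (by positivity)
  rw [Real.logb_mul (by positivity) hm.ne', Real.logb_pow,
    Real.logb_self_eq_one one_lt_two] at h
  linarith

/-- Repeatedly merging the two smallest weights, as long as at least two weights are at most `P`,
and then using a fixed-length code on the `2 ^ l` remaining weights. -/
theorem exists_hasCodeCost_le (P : ℝ) (N : ℕ) : ∀ (S : Multiset ℝ) (l : ℕ) (t : ℝ),
    S.card = N → 2 ^ l ≤ N → 2 * N ≤ S.countP (· ≤ P) + 2 * 2 ^ l → S.sum = 1 →
    (∀ x ∈ S, 0 ≤ x) → (∀ x ∈ S, P < x → ∀ y ∈ S, x ≤ 2 * y) → t ≤ P → (∀ x ∈ S, t ≤ x) →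
    ∃ L, HasCodeCost S L ∧
      L + (S.map fun x => x * Real.logb 2 x).sum ≤ gallagerSigma + P - t := by
  induction N with
  | zero =>
    intro S l t _ h
    exact absurd h (by simp)
  | succ N ih =>
    intro S l t hcard hl hcount hsum hnn hratio htP ht
    have merge : ∀ l, 2 ^ l ≤ N → 2 * (N + 1) ≤ S.countP (· ≤ P) + 2 * 2 ^ l →
        ∃ L, HasCodeCost S L ∧
          L + (S.map fun x => x * Real.logb 2 x).sum ≤ gallagerSigma + P - t := by
      intro l hl hcount
      have hS : S ≠ 0 := by rintro rfl; simp at hsum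
      obtain ⟨b, S₁, rfl, hb⟩ := Multiset.exists_eq_cons_forall_le hS
      have hS₁ : S₁ ≠ 0 := by
        rintro rfl
        have : 0 < 2 ^ l := by positivity
        simp at hcard
        omega
      obtain ⟨a, S₂, rfl, ha⟩ := Multiset.exists_eq_cons_forall_le hS₁
      have hba : b ≤ a := hb a (by simp)
      have hb₀ : 0 ≤ b := hnn b (by simp)
      have haP : a ≤ P := by
        by_contra! haP
        have h₀ : S₂.countP (· ≤ P) = 0 :=
          Multiset.countP_eq_zero.2 fun x hx => by linarith [ha x hx]
        rw [Multiset.countP_cons, Multiset.countP_cons, h₀, if_neg haP.not_ge] at hcount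
        split_ifs at hcount <;> omega
      have hcount' : 2 * N ≤ ((a + b) ::ₘ S₂).countP (· ≤ P) + 2 * 2 ^ l := by
        rw [Multiset.countP_cons, Multiset.countP_cons] at hcount
        rw [Multiset.countP_cons]
        split_ifs at hcount ⊢ <;> omega
      obtain ⟨L, hL, hLe⟩ := ih ((a + b) ::ₘ S₂) l a (by simp at hcard ⊢; omega) hl hcount'
        (by simp at hsum ⊢; linarith)
        (by
          simp only [Multiset.mem_cons, forall_eq_or_imp]
          exact ⟨by linarith, fun x hx => hnn x (by simp [hx])⟩)
        (by
          simp only [Multiset.mem_cons, forall_eq_or_imp]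
          refine ⟨fun _ => ⟨by linarith, fun y hy => by linarith [ha y hy]⟩,
            fun x hx hPx => ?_⟩
          have := hratio x (by simp [hx]) hPx b (by simp)
          exact ⟨by linarith, fun y hy => by linarith [ha y hy]⟩)
        haP
        (by
          simp only [Multiset.mem_cons, forall_eq_or_imp]
          exact ⟨by linarith, ha⟩)
      refine ⟨_, hL.split, ?_⟩
      have h := merge_redundancy_le hb₀ hba
      have htb := ht b (by simp)
      simp only [Multiset.map_cons, Multiset.sum_cons] at hLe ⊢
      linarith
    have fixedLength : S.card = 2 ^ l → (∀ x ∈ S, ∀ y ∈ S, x ≤ 2 * y) →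
        ∃ L, HasCodeCost S L ∧
          L + (S.map fun x => x * Real.logb 2 x).sum ≤ gallagerSigma + P - t := by
      intro hc hr
      refine ⟨_, hasCodeCost_of_card_eq_two_pow l S hc, ?_⟩
      have := card_two_pow_redundancy_le hc hsum hr
      rw [hsum, mul_one]
      linarith
    rcases hl.lt_or_eq with hlt | heq
    · exact merge l (by omega) hcount
    by_cases hall : ∀ x ∈ S, x ≤ P
    · cases l with
      | zero =>
        refine fixedLength (by omega) ?_
        obtain ⟨x, rfl⟩ := Multiset.card_eq_one.1 (by rw [hcard, ← heq]; simp)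
        simp only [Multiset.mem_singleton, forall_eq]
        linarith [hnn x (by simp)]
      | succ l =>
        have hpos : 0 < 2 ^ l := by positivity
        rw [pow_succ] at heq
        refine merge l (by omega) ?_
        rw [Multiset.countP_eq_card.2 hall]
        omega
    · push Not at hall
      obtain ⟨z, hz, hPz⟩ := hall
      refine fixedLength (by omega) fun x hx y hy => ?_
      rcases le_or_gt x P with hxP | hxP
      · linarith [hratio z hz hPz y hy]
      · exact hratio x hx hxP y hy

/-- Gallager's redundancy bound: the redundancy of the optimal prefix-free code
is at most the largest probability plus `σ`. -/
theorem gallager_redundancy_bound (n : ℕ) (hn : 1 ≤ n) (p : Fin n → ℝ)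
    (hp : IsProbVec p) (p₁ : ℝ) (hmax : ∀ i, p i ≤ p₁) (hach : ∃ i, p i = p₁) :
    LH p - entropy p ≤ p₁ + gallagerSigma := by
  obtain ⟨hnn, hsum⟩ := hp
  set S : Multiset ℝ := Finset.univ.val.map p with hS
  have hcard : S.card = n := by simp [hS]
  have hle : ∀ x ∈ S, x ≤ p₁ := by simpa [hS] using hmax
  have hnn' : ∀ x ∈ S, 0 ≤ x := by simpa [hS] using hnn
  obtain ⟨i, hi⟩ := hach
  have hlog : 2 ^ Nat.log 2 n ≤ n := Nat.pow_log_le_self 2 (by omega)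
  have hlog' : n < 2 ^ (Nat.log 2 n + 1) := Nat.lt_pow_succ_log_self one_lt_two n
  rw [pow_succ] at hlog'
  obtain ⟨L, hL, hLe⟩ := exists_hasCodeCost_le p₁ n S (Nat.log 2 n) 0 hcard hlog
    (by rw [Multiset.countP_eq_card.2 hle, hcard]; omega) hsum hnn'
    (fun x hx h => absurd (hle x hx) h.not_ge) (hi ▸ hnn i) hnn'
  have hent : (S.map fun x => x * Real.logb 2 x).sum = -entropy p := by
    simp [hS, entropy, Finset.sum, Function.comp_def]
  have := LH_le_of_hasCodeCost hnn hL
  linarith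
end

section
/- Let n ≥ 2 and let p : Fin n → ℝ be a probability vector with p i > 0 for all i. Then L_H(p) < L_yes(p): the infimum of average lengths over prefix-free terminating-yes codes is strictly greater than the infimum of average lengths over all prefix-free codes. -/
/-- The unary code `false ^ i ++ [true]` is a prefix-free terminating-yes code. -/
theorem exists_isPrefixFreeCode_isTermYes (n : ℕ) :
    ∃ c : Fin n → List Bool, IsPrefixFreeCode c ∧ IsTermYes c := by
  have key : ∀ a b : ℕ, (List.replicate a false ++ [true]) <+: (List.replicate b false ++ [true]) →
      a = b := by
    intro a
    induction a with
    | zero => intro b h; cases b <;> simp_all [List.replicate_succ]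
    | succ a ih =>
      intro b h
      cases b with
      | zero => simp [List.replicate_succ] at h
      | succ b =>
        simp only [List.replicate_succ, List.cons_append, List.cons_prefix_cons, true_and] at h
        rw [ih b h]
  refine ⟨fun i => List.replicate i false ++ [true], ⟨?_, ?_⟩, ?_⟩
  · intro i j h
    exact Fin.ext (key i j ⟨[], by simpa using h⟩)
  · intro i j hij h
    exact hij (Fin.ext (key i j h))
  · intro i
    simp

/-- In a prefix-free terminating-yes code, the last symbol of a longest codeword can be dropped. -/
theorem IsPrefixFreeCode.update_dropLast {n : ℕ} {c : Fin n → List Bool}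
    (hc : IsPrefixFreeCode c) (hy : IsTermYes c) {i : Fin n}
    (hi : ∀ j, (c j).length ≤ (c i).length) :
    IsPrefixFreeCode (Function.update c i (c i).dropLast) := by
  have hpf : ∀ j k, j ≠ k →
      ¬ Function.update c i (c i).dropLast j <+: Function.update c i (c i).dropLast k := by
    intro j k hjk h
    by_cases hji : j = i
    · subst hji
      rw [Function.update_self, Function.update_of_ne hjk.symm] at h
      obtain ⟨w, hw⟩ := List.getLast?_eq_some_iff.1 (hy j).2
      obtain ⟨v, hv⟩ := List.getLast?_eq_some_iff.1 (hy k).2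
      have hl := hi k
      have hp := hc.2 k j hjk.symm
      rw [hw, hv] at hl hp
      rw [hw, hv, List.dropLast_concat] at h
      rcases (List.prefix_concat_iff).1 h with h | h
      · exact hp (h ▸ List.prefix_append w [true])
      · have : w = v := h.eq_of_length_le (by simpa using hl)
        exact hp (this ▸ List.prefix_refl _)
    · rw [Function.update_of_ne hji] at h
      by_cases hki : k = i
      · subst hki
        rw [Function.update_self] at h
        exact hc.2 j k hjk (h.trans (List.dropLast_prefix _))
      · rw [Function.update_of_ne hki] at h
        exact hc.2 j k hjk h
  refine ⟨fun j k h => ?_, hpf⟩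
  by_contra hjk
  exact hpf j k hjk (h ▸ List.prefix_refl _)

theorem avgLen_update_dropLast {n : ℕ} (p : Fin n → ℝ) {c : Fin n → List Bool} {i : Fin n}
    (hi : c i ≠ []) :
    avgLen p (Function.update c i (c i).dropLast) + p i = avgLen p c := by
  have hlen : ((c i).dropLast.length : ℝ) + 1 = (c i).length := by
    have := List.length_pos_iff.2 hi
    rw [List.length_dropLast]
    exact_mod_cast Nat.sub_add_cancel this
  have hsum : ∑ j ∈ Finset.univ.erase i,
      p j * ((Function.update c i (c i).dropLast j).length : ℝ) =
      ∑ j ∈ Finset.univ.erase i, p j * ((c j).length : ℝ) :=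
    Finset.sum_congr rfl fun j hj => by rw [Function.update_of_ne (Finset.ne_of_mem_erase hj)]
  unfold avgLen
  rw [← Finset.add_sum_erase _ _ (Finset.mem_univ i),
    ← Finset.add_sum_erase _ (fun j => p j * ((c j).length : ℝ)) (Finset.mem_univ i),
    hsum, Function.update_self, ← hlen]
  ring

/-- For a strictly positive probability vector on at least two objects,
the optimal terminating-yes average length strictly exceeds the optimal
prefix-free average length. -/
theorem LH_lt_Lyes (n : ℕ) (hn : 2 ≤ n) (p : Fin n → ℝ)
    (hp : IsProbVec p) (hpos : ∀ i, 0 < p i) :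
    LH p < Lyes p := by
  have : NeZero n := ⟨by omega⟩
  obtain ⟨m, hm⟩ := Finite.exists_min p
  refine (lt_add_of_pos_right _ (hpos m)).trans_le (le_csInf ?_ ?_)
  · obtain ⟨c, hc, hy⟩ := exists_isPrefixFreeCode_isTermYes n
    exact ⟨_, c, hc, hy, rfl⟩
  · rintro _ ⟨c, hc, hy, rfl⟩
    obtain ⟨i, hi⟩ := Finite.exists_max fun j => (c j).length
    have hbdd : BddBelow {L : ℝ | ∃ c : Fin n → List Bool, IsPrefixFreeCode c ∧ avgLen p c = L} := by
      refine ⟨0, ?_⟩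
      rintro _ ⟨c, -, rfl⟩
      exact Finset.sum_nonneg fun j _ => mul_nonneg (hp.1 j) (Nat.cast_nonneg _)
    rw [← avgLen_update_dropLast p (hy i).1]
    exact add_le_add (csInf_le hbdd ⟨_, hc.update_dropLast hy hi, rfl⟩) (hm i)
end

section
/- Let n ≥ 2 and let p : Fin n → ℝ be a probability vector with p i > 0 for all i. Then H(p) < L_yes(p): the average number of questions of any Twenty Questions strategy in which every codeword ends with 'Yes' strictly exceeds the entropy. -/
/-- A prefix-free set of nonempty words is uniquely decodable. -/
theorem uniquelyDecodable_of_prefix_free {α : Type*} {S : Set (List α)} (hnil : [] ∉ S)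
    (hS : ∀ u ∈ S, ∀ v ∈ S, u <+: v → u = v) :
    InformationTheory.UniquelyDecodable S := by
  intro L₁
  induction L₁ with
  | nil =>
    rintro (_ | ⟨v, L₂⟩) _ h₂ h
    · rfl
    · have hv : v = [] := by simp_all
      exact absurd (hv ▸ h₂ v (by simp)) hnil
  | cons u L₁ ih =>
    rintro (_ | ⟨v, L₂⟩) h₁ h₂ h
    · have hu : u = [] := by simp_all
      exact absurd (hu ▸ h₁ u (by simp)) hnil
    · have hu := h₁ u (by simp)
      have hv := h₂ v (by simp)
      simp only [List.flatten_cons] at h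
      have huv : u = v := by
        rcases List.prefix_or_prefix_of_prefix (List.prefix_append u L₁.flatten)
          (h ▸ List.prefix_append v L₂.flatten) with h' | h'
        · exact hS u hu v hv h'
        · exact (hS v hv u hu h').symm
      subst huv
      rw [ih L₂ (fun w hw => h₁ w (by simp [hw])) (fun w hw => h₂ w (by simp [hw]))
        (List.append_cancel_left h)]

/-- Kraft's inequality for terminating-yes codes with a quantitative slack: the all-`false` word
of length `M` can be added to the code. -/
theorem IsPrefixFreeCode.kraft_add_le_one {n : ℕ} {c : Fin n → List Bool}
    (hc : IsPrefixFreeCode c) (hy : IsTermYes c) {M : ℕ} (hM : 0 < M)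
    (hlen : ∀ i, (c i).length < M) :
    ∑ i, (1 / 2 : ℝ) ^ (c i).length + (1 / 2 : ℝ) ^ M ≤ 1 := by
  have hnot : ∀ i, ¬ c i <+: List.replicate M false := by
    intro i h
    have hmem : true ∈ List.replicate M false :=
      h.subset (List.mem_of_getLast? (hy i).2)
    simp at hmem
  have hnot' : ∀ i, ¬ List.replicate M false <+: c i := by
    intro i h
    have := h.length_le
    have := hlen i
    simp at *
    omega
  have hnew : List.replicate M false ∉ Finset.univ.image c := by
    intro h
    obtain ⟨i, -, hi⟩ := Finset.mem_image.1 h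
    exact hnot i (hi ▸ List.prefix_rfl)
  have hud : InformationTheory.UniquelyDecodable
      ((insert (List.replicate M false) (Finset.univ.image c) : Finset (List Bool)) :
        Set (List Bool)) := by
    apply uniquelyDecodable_of_prefix_free
    · simp only [Finset.mem_coe, Finset.mem_insert, Finset.mem_image, Finset.mem_univ, true_and]
      rintro (h | ⟨i, hi⟩)
      · have := congrArg List.length h
        simp at this
        omega
      · exact (hy i).1 hi
    · simp only [Finset.mem_coe, Finset.mem_insert, Finset.mem_image, Finset.mem_univ, true_and]
      rintro u (rfl | ⟨i, rfl⟩) v (rfl | ⟨j, rfl⟩) h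
      · rfl
      · exact absurd h (hnot' j)
      · exact absurd h (hnot i)
      · by_contra hne
        exact hc.2 i j (fun hij => hne (hij ▸ rfl)) h
  have h := InformationTheory.kraft_mcmillan_inequality hud
  rw [Finset.sum_insert hnew, Finset.sum_image fun i _ j _ hij => hc.1 hij] at h
  simp only [Fintype.card_bool, Nat.cast_ofNat, List.length_replicate] at h
  linarith

/-- Gibbs' inequality for code lengths, with the Kraft defect as a lower bound on the redundancy. -/
theorem entropy_add_kraft_defect_le_avgLen {n : ℕ} {p : Fin n → ℝ} (hp : IsProbVec p)
    (hpos : ∀ i, 0 < p i) {c : Fin n → List Bool}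
    (hc : ∑ i, (1 / 2 : ℝ) ^ (c i).length ≤ 1) :
    entropy p + (1 - ∑ i, (1 / 2 : ℝ) ^ (c i).length) ≤ avgLen p c := by
  have hlog : 0 < Real.log 2 := Real.log_pos (by norm_num)
  have hlog1 : Real.log 2 ≤ 1 := by
    have := Real.log_le_sub_one_of_pos (x := 2) (by norm_num)
    linarith
  have key : ∀ i, p i - (1 / 2 : ℝ) ^ (c i).length ≤
      Real.log 2 * (p i * (c i).length + p i * Real.logb 2 (p i)) := by
    intro i
    have hq : (0 : ℝ) < (1 / 2 : ℝ) ^ (c i).length := by positivity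
    have h := Real.log_le_sub_one_of_pos (div_pos hq (hpos i))
    rw [Real.log_div hq.ne' (hpos i).ne', Real.log_pow, one_div, Real.log_inv] at h
    have h' := mul_le_mul_of_nonneg_left h (hpos i).le
    have e : p i * ((2⁻¹ : ℝ) ^ (c i).length / p i - 1) = (2⁻¹ : ℝ) ^ (c i).length - p i := by
      have := (hpos i).ne'
      field_simp
    rw [e] at h'
    have e' : Real.log 2 * Real.logb 2 (p i) = Real.log (p i) := by
      rw [Real.logb]
      field_simp
    rw [one_div, mul_add, mul_left_comm (Real.log 2) (p i) (Real.logb _ _), e']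
    linarith
  have hsum := Finset.sum_le_sum fun i (_ : i ∈ Finset.univ) => key i
  rw [Finset.sum_sub_distrib, hp.2, ← Finset.mul_sum, Finset.sum_add_distrib] at hsum
  unfold entropy avgLen
  nlinarith

/-- Strict entropy lower bound: the optimal terminating-yes average length
strictly exceeds the entropy. -/
theorem entropy_lt_Lyes (n : ℕ) (hn : 2 ≤ n) (p : Fin n → ℝ)
    (hp : IsProbVec p) (hpos : ∀ i, 0 < p i) :
    entropy p < Lyes p := by
  obtain ⟨B, hB⟩ := (Set.finite_range fun i => (entropy p + 1) / p i).bddAbove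
  obtain ⟨M, hM⟩ := exists_nat_gt B
  have hε : (0 : ℝ) < (1 / 2 : ℝ) ^ M := by positivity
  have hε1 : (1 / 2 : ℝ) ^ M ≤ 1 := pow_le_one₀ (by norm_num) (by norm_num)
  refine (lt_add_of_pos_right _ hε).trans_le (le_csInf ?_ ?_)
  · obtain ⟨c, hc, hy⟩ := exists_isPrefixFreeCode_isTermYes n
    exact ⟨_, c, hc, hy, rfl⟩
  · rintro _ ⟨c, hc, hy, rfl⟩
    by_cases hL : avgLen p c < entropy p + 1
    · have hlen : ∀ i, (c i).length < M := by
        intro i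
        have h₁ : p i * ((c i).length : ℝ) ≤ avgLen p c :=
          Finset.single_le_sum (f := fun i => p i * ((c i).length : ℝ))
            (fun j _ => mul_nonneg (hpos j).le (Nat.cast_nonneg _)) (Finset.mem_univ i)
        have h₂ : ((c i).length : ℝ) < (entropy p + 1) / p i := by
          rw [lt_div_iff₀ (hpos i)]
          linarith
        have h₃ : (entropy p + 1) / p i ≤ B := hB ⟨i, rfl⟩
        exact_mod_cast (h₂.trans_le h₃).trans hM
      have hk := hc.kraft_add_le_one hy (Nat.zero_lt_of_lt (hlen ⟨0, by omega⟩)) hlen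
      have := entropy_add_kraft_defect_le_avgLen hp hpos (c := c) (by linarith)
      linarith
    · linarith
end

section
/- Let n ≥ 2 and let p : Fin n → ℝ be a probability vector with p i > 0 for all i. Then L_yes(p) < H(p) + 1: there exists a prefix-free terminating-yes code whose average length is strictly less than the entropy plus one. -/
/-- The codewords of the indices in `s` are pairwise incomparable for the prefix order. -/
def PrefixFreeOn {ι : Type*} (s : Finset ι) (c : ι → List Bool) : Prop :=
  ∀ i ∈ s, ∀ j ∈ s, i ≠ j → ¬ (c i <+: c j)

/-- Converse of Kraft's inequality: lengths with Kraft sum at most one are the codeword lengths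
of a prefix-free code. -/
lemma exists_prefixFreeOn_of_kraft {ι : Type*} (l : ι → ℕ) (s : Finset ι) :
    ∑ i ∈ s, (2 : ℝ)⁻¹ ^ l i ≤ 1 → ∃ c : ι → List Bool, PrefixFreeOn s c ∧
      ∀ i ∈ s, (c i).length = l i := by
  classical
  induction s using Finset.induction_on_max_value l with
  | empty => exact fun _ => ⟨fun _ => [], by simp [PrefixFreeOn], by simp⟩
  | insert a s ha hmax ih =>
    intro h
    rw [Finset.sum_insert ha] at h
    have hpa : 0 < (2 : ℝ)⁻¹ ^ l a := by positivity
    obtain ⟨c, hc, hl⟩ := ih (by linarith)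
    let extensions : Finset (List Bool) := s.biUnion fun j =>
      Finset.univ.image fun v : List.Vector Bool (l a - l j) => c j ++ v.toList
    let words : Finset (List Bool) :=
      Finset.univ.image fun v : List.Vector Bool (l a) => v.toList
    have hwords : words.card = 2 ^ l a := by
      rw [Finset.card_image_of_injective _ List.Vector.toList_injective, Finset.card_univ,
        card_vector, Fintype.card_bool]
    have hext : extensions.card ≤ ∑ j ∈ s, 2 ^ (l a - l j) := by
      refine Finset.card_biUnion_le.trans (Finset.sum_le_sum fun j _ => ?_)
      refine Finset.card_image_le.trans ?_
      rw [Finset.card_univ, card_vector, Fintype.card_bool]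
    have hlt : ∑ j ∈ s, 2 ^ (l a - l j) < 2 ^ l a := by
      have hsum : ∑ j ∈ s, (2 : ℝ) ^ (l a - l j) = 2 ^ l a * ∑ j ∈ s, (2 : ℝ)⁻¹ ^ l j := by
        rw [Finset.mul_sum]
        refine Finset.sum_congr rfl fun j hj => ?_
        rw [pow_sub₀ _ two_ne_zero (hmax j hj), inv_pow]
      have : ∑ j ∈ s, (2 : ℝ) ^ (l a - l j) < 2 ^ l a := by
        rw [hsum]
        exact mul_lt_of_lt_one_right (by positivity) (by linarith)
      exact_mod_cast this
    obtain ⟨w, hw, hw'⟩ := Finset.exists_mem_notMem_of_card_lt_card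
      (hext.trans_lt (hlt.trans_eq hwords.symm))
    have hwl : w.length = l a := by
      obtain ⟨v, -, rfl⟩ := Finset.mem_image.1 hw
      exact v.toList_length
    have hnot : ∀ j ∈ s, ¬ (c j <+: w) := by
      rintro j hj ⟨t, rfl⟩
      rw [List.length_append, hl j hj] at hwl
      let v : List.Vector Bool (l a - l j) := ⟨t, by omega⟩
      exact hw' (Finset.mem_biUnion.2
        ⟨j, hj, Finset.mem_image.2 ⟨v, Finset.mem_univ v, rfl⟩⟩)
    have hne : ∀ j ∈ s, j ≠ a := fun j hj h => ha (h ▸ hj)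
    refine ⟨Function.update c a w, ?_, ?_⟩
    · intro i hi j hj hij
      rcases Finset.mem_insert.1 hi with hia | hi <;> rcases Finset.mem_insert.1 hj with hja | hj
      · exact absurd (hia.trans hja.symm) hij
      · rw [hia, Function.update_self, Function.update_of_ne (hne j hj)]
        intro hpre
        have : w = c j := hpre.eq_of_length_le (by rw [hwl, hl j hj]; exact hmax j hj)
        exact hnot j hj (this ▸ List.prefix_rfl)
      · rw [hja, Function.update_self, Function.update_of_ne (hne i hi)]
        exact hnot i hi
      · rw [Function.update_of_ne (hne i hi), Function.update_of_ne (hne j hj)]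
        exact hc i hi j hj hij
    · intro i hi
      rcases Finset.mem_insert.1 hi with rfl | hi
      · rw [Function.update_self, hwl]
      · rw [Function.update_of_ne (hne i hi), hl i hi]

lemma two_rpow_mul_one_sub_half_le {x : ℝ} (hx : 0 ≤ x) :
    (2 : ℝ) ^ x * (1 - x / 2) ≤ 2 ^ (1 / 8 : ℝ) := by
  have h1 := Real.log_two_gt_d9
  have h2 := Real.log_two_lt_d9
  have hlin : 1 - x / 2 ≤ 18 / 25 * Real.exp (7 / 18 - 25 / 36 * x) := by
    have := Real.add_one_le_exp (7 / 18 - 25 / 36 * x)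
    linarith
  have hconst : (18 / 25 : ℝ) ≤ Real.exp (Real.log 2 / 8 - 7 / 18) := by
    have h := Real.add_one_le_exp ((Real.log 2 / 8 - 7 / 18) / 2)
    calc (18 / 25 : ℝ) ≤ Real.exp ((Real.log 2 / 8 - 7 / 18) / 2) ^ 2 := by
          nlinarith
      _ = Real.exp (Real.log 2 / 8 - 7 / 18) := by
          rw [← Real.exp_nat_mul]; congr 1; push_cast; ring
  rw [Real.rpow_def_of_pos two_pos, Real.rpow_def_of_pos two_pos]
  calc Real.exp (Real.log 2 * x) * (1 - x / 2)
      ≤ Real.exp (Real.log 2 * x) * (Real.exp (Real.log 2 / 8 - 7 / 18) *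
          Real.exp (7 / 18 - 25 / 36 * x)) := by
        gcongr
        exact hlin.trans (by gcongr)
    _ = Real.exp (Real.log 2 / 8 + x * (Real.log 2 - 25 / 36)) := by
        rw [← Real.exp_add, ← Real.exp_add]; congr 1; ring
    _ ≤ Real.exp (Real.log 2 * (1 / 8)) := by
        gcongr
        nlinarith

/-- If the pointwise redundancies `l i + logb 2 (p i)` lie in a window of length one and average
to at least `1 / 8`, then the lengths `l` satisfy Kraft's inequality. -/
lemma kraft_of_redundancy {ι : Type*} {s : Finset ι} {p : ι → ℝ} (hp : ∀ i ∈ s, 0 < p i)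
    (hsum : ∑ i ∈ s, p i = 1) {l : ι → ℕ} {b : ℝ}
    (hl : ∀ i ∈ s, b ≤ l i + Real.logb 2 (p i)) (hu : ∀ i ∈ s, l i + Real.logb 2 (p i) ≤ b + 1)
    (hR : 1 / 8 ≤ ∑ i ∈ s, p i * (l i + Real.logb 2 (p i))) :
    ∑ i ∈ s, (2 : ℝ)⁻¹ ^ l i ≤ 1 := by
  set R := ∑ i ∈ s, p i * (l i + Real.logb 2 (p i)) with hRdef
  have hbR : b ≤ R := by
    calc b = ∑ i ∈ s, p i * b := by rw [← Finset.sum_mul, hsum, one_mul]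
      _ ≤ R := Finset.sum_le_sum fun i hi => mul_le_mul_of_nonneg_left (hl i hi) (hp i hi).le
  have hterm : ∀ i ∈ s, (2 : ℝ)⁻¹ ^ l i ≤
      2 ^ (-b) * (p i * (1 + b / 2) - p i * (l i + Real.logb 2 (p i)) / 2) := by
    intro i hi
    have hpi := hp i hi
    set r := l i + Real.logb 2 (p i) with hr
    have h1 : (2 : ℝ)⁻¹ ^ l i = 2 ^ (-b) * (p i * (2 : ℝ)⁻¹ ^ (r - b)) := by
      have hpe : p i = (2 : ℝ) ^ (Real.logb 2 (p i)) :=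
        (Real.rpow_logb two_pos (by norm_num) hpi).symm
      rw [Real.inv_rpow two_pos.le, ← Real.rpow_neg two_pos.le]
      nth_rewrite 1 [hpe]
      rw [← Real.rpow_add two_pos, ← Real.rpow_add two_pos, inv_pow, ← Real.rpow_natCast,
        ← Real.rpow_neg two_pos.le]
      congr 1
      rw [hr]; ring
    have h2 : (2 : ℝ)⁻¹ ^ (r - b) ≤ 1 - (r - b) / 2 := by
      have := rpow_one_add_le_one_add_mul_self (s := -(1 / 2)) (p := r - b) (by norm_num)
        (by linarith [hl i hi]) (by linarith [hu i hi])
      norm_num at this ⊢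
      linarith
    rw [h1]
    have := mul_le_mul_of_nonneg_left h2 hpi.le
    gcongr
    linarith
  calc ∑ i ∈ s, (2 : ℝ)⁻¹ ^ l i
      ≤ ∑ i ∈ s, 2 ^ (-b) * (p i * (1 + b / 2) - p i * (l i + Real.logb 2 (p i)) / 2) :=
        Finset.sum_le_sum hterm
    _ = 2 ^ (-R) * (2 ^ (R - b) * (1 - (R - b) / 2)) := by
        rw [← Finset.mul_sum, Finset.sum_sub_distrib, ← Finset.sum_mul, ← Finset.sum_div, hsum,
          ← hRdef, ← mul_assoc, ← Real.rpow_add two_pos]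
        ring_nf
    _ ≤ 2 ^ (-R) * 2 ^ (1 / 8 : ℝ) := by
        gcongr
        exact two_rpow_mul_one_sub_half_le (by linarith)
    _ ≤ 1 := by
        rw [← Real.rpow_add two_pos]
        exact Real.rpow_le_one_of_one_le_of_nonpos one_le_two (by linarith)

/-- Lengths obtained by repeatedly lengthening a codeword of minimal redundancy: if all
probabilities are at most `3 / 8`, Kraft's inequality can be met with average redundancy below
one half. -/
lemma exists_lengths_redundancy_lt_half {ι : Type*} {s : Finset ι} {p : ι → ℝ}
    (hp : ∀ i ∈ s, 0 < p i) (hsum : ∑ i ∈ s, p i = 1) (hsmall : ∀ i ∈ s, p i ≤ 3 / 8) :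
    ∃ l : ι → ℕ, ∑ i ∈ s, (2 : ℝ)⁻¹ ^ l i ≤ 1 ∧
      ∑ i ∈ s, p i * (l i + Real.logb 2 (p i)) < 1 / 2 := by
  classical
  have hne : s.Nonempty := by
    rw [Finset.nonempty_iff_ne_empty]; rintro rfl; simp at hsum
  let r : (ι → ℕ) → ι → ℝ := fun l i => l i + Real.logb 2 (p i)
  let good : (ι → ℕ) → Prop := fun l =>
    (∀ i ∈ s, ∀ j ∈ s, r l i ≤ r l j + 1) ∧ ∑ i ∈ s, p i * r l i < 1 / 2
  let S : Set ℕ := {k | ∃ l, good l ∧ ∑ i ∈ s, l i = k}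
  have hSne : S.Nonempty := by
    let l₀ : ι → ℕ := fun i => ⌊-Real.logb 2 (p i)⌋₊
    have hnn : ∀ i ∈ s, 0 ≤ -Real.logb 2 (p i) := fun i hi =>
      neg_nonneg.2 (Real.logb_nonpos one_lt_two (hp i hi).le (by linarith [hsmall i hi]))
    have hlo : ∀ i ∈ s, -1 ≤ r l₀ i := fun i _ => by
      have := Nat.lt_floor_add_one (-Real.logb 2 (p i))
      simp only [r, l₀]; linarith
    have hhi : ∀ i ∈ s, r l₀ i ≤ 0 := fun i hi => by
      have := Nat.floor_le (hnn i hi)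
      simp only [r, l₀]; linarith
    refine ⟨_, l₀, ⟨fun i hi j hj => by linarith [hhi i hi, hlo j hj], ?_⟩, rfl⟩
    have : ∑ i ∈ s, p i * r l₀ i ≤ 0 :=
      Finset.sum_nonpos fun i hi => mul_nonpos_of_nonneg_of_nonpos (hp i hi).le (hhi i hi)
    linarith
  have hSbdd : BddAbove S := by
    obtain ⟨m, hm, hmin⟩ := s.exists_min_image p hne
    have hpm := hp m hm
    refine ⟨⌊(1 / 2 - ∑ i ∈ s, p i * Real.logb 2 (p i)) / p m⌋₊, ?_⟩
    rintro _ ⟨l, ⟨-, hl⟩, rfl⟩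
    refine Nat.le_floor ((le_div_iff₀ hpm).2 ?_)
    have h1 : (∑ i ∈ s, (l i : ℝ)) * p m ≤ ∑ i ∈ s, p i * l i := by
      rw [Finset.sum_mul]
      refine Finset.sum_le_sum fun i hi => ?_
      rw [mul_comm]
      exact mul_le_mul_of_nonneg_right (hmin i hi) (Nat.cast_nonneg _)
    simp only [r, mul_add, Finset.sum_add_distrib] at hl
    push_cast
    linarith
  obtain ⟨l, ⟨hspread, hR⟩, hlS⟩ := Nat.sSup_mem hSne hSbdd
  refine ⟨l, ?_, hR⟩
  obtain ⟨m, hm, hmin⟩ := s.exists_min_image (r l) hne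
  refine kraft_of_redundancy hp hsum hmin (fun i hi => hspread i hi m hm) ?_
  by_contra! hlt
  have hlt' : ∑ i ∈ s, p i * r l i < 1 / 8 := hlt
  let l' := Function.update l m (l m + 1)
  have hr' : ∀ i, r l' i = r l i + if i = m then 1 else 0 := by
    intro i
    by_cases h : i = m
    · subst h; simp [r, l']; ring
    · simp [r, l', h]
  have hmem : ∑ i ∈ s, l' i ∈ S := by
    refine ⟨l', ⟨fun i hi j hj => ?_, ?_⟩, rfl⟩
    · rw [hr', hr']
      have h1 := hmin j hj
      have h2 := hspread i hi j hj
      split_ifs with hi' hj' <;> subst_vars <;> linarith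
    · simp only [hr', mul_add, Finset.sum_add_distrib, mul_ite, mul_one, mul_zero,
        Finset.sum_ite_eq', hm, if_true]
      linarith [hsmall m hm]
  have hle := le_csSup hSbdd hmem
  rw [← hlS, Finset.sum_update_of_mem hm] at hle
  have := Finset.add_sum_erase s l hm
  rw [Finset.sdiff_singleton_eq_erase] at hle
  omega

/-- Appending `true` to the codewords of a prefix-free code that end with `false` keeps the code
prefix-free, and after complementing all bits if necessary this lengthens the code by at most
one half on average. -/
lemma exists_termYes_of_prefixFreeOn {ι : Type*} {s : Finset ι} {p : ι → ℝ}
    (hsum : ∑ i ∈ s, p i = 1) {c : ι → List Bool} (hc : PrefixFreeOn s c)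
    (hne : ∀ i ∈ s, c i ≠ []) :
    ∃ c' : ι → List Bool, PrefixFreeOn s c' ∧ (∀ i ∈ s, (c' i).getLast? = some true) ∧
      ∑ i ∈ s, p i * ((c' i).length : ℝ) ≤ ∑ i ∈ s, p i * ((c i).length : ℝ) + 1 / 2 := by
  classical
  let fix : List Bool → List Bool := fun w => if w.getLast? = some true then w else w ++ [true]
  have hfix_last : ∀ w, (fix w).getLast? = some true := by
    intro w; by_cases h : w.getLast? = some true <;> simp [fix, h]
  have hfix_pf : ∀ d : ι → List Bool, PrefixFreeOn s d → PrefixFreeOn s (fun i => fix (d i)) := by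
    intro d hd i hi j hj hij hpre
    have hij' := hd i hi j hj hij
    have hji' := hd j hj i hi hij.symm
    have hpre' : d i <+: fix (d j) := by
      refine List.IsPrefix.trans ?_ hpre
      by_cases h : (d i).getLast? = some true <;> simp [fix, h]
    by_cases h : (d j).getLast? = some true
    · simp only [fix, h, if_true] at hpre'
      exact hij' hpre'
    · simp only [fix, h, if_false] at hpre'
      rcases List.prefix_concat_iff.1 hpre' with h' | h'
      · exact hji' (h' ▸ List.prefix_append _ _)
      · exact hij' h'
  have hlen : ∀ w, ((fix w).length : ℝ) = w.length + if w.getLast? = some true then 0 else 1 := by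
    intro w; by_cases h : w.getLast? = some true <;> simp [fix, h]
  let cost : (ι → List Bool) → ℝ := fun d =>
    ∑ i ∈ s, p i * (if (d i).getLast? = some true then 0 else 1)
  have havg : ∀ d : ι → List Bool, ∑ i ∈ s, p i * ((fix (d i)).length : ℝ) =
      ∑ i ∈ s, p i * ((d i).length : ℝ) + cost d := by
    intro d
    simp only [hlen, mul_add, Finset.sum_add_distrib, cost]
  let flip : ι → List Bool := fun i => (c i).map Bool.not
  have hflip_pf : PrefixFreeOn s flip := by
    intro i hi j hj hij hpre
    have := List.IsPrefix.map Bool.not hpre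
    simp only [flip, List.map_map, Bool.involutive_not.comp_self, List.map_id] at this
    exact hc i hi j hj hij this
  have hcost : cost c + cost flip = 1 := by
    simp only [cost]
    rw [← Finset.sum_add_distrib]
    refine Eq.trans ?_ hsum
    refine Finset.sum_congr rfl fun i hi => ?_
    obtain ⟨w, b, hw⟩ : ∃ w b, c i = w ++ [b] :=
      ⟨_, _, (List.dropLast_append_getLast (hne i hi)).symm⟩
    cases b <;> simp [flip, hw]
  rcases le_total (cost c) (1 / 2) with h | h
  · exact ⟨fun i => fix (c i), hfix_pf c hc, fun i _ => hfix_last _, by rw [havg]; linarith⟩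
  · refine ⟨fun i => fix (flip i), hfix_pf flip hflip_pf, fun i _ => hfix_last _, ?_⟩
    rw [havg]
    have : ∀ i, (flip i).length = (c i).length := fun i => by simp [flip]
    simp only [this]
    linarith

lemma one_sub_lt_entropy_of_large {a : ℝ} (ha : 3 / 8 < a) (ha1 : a < 1) :
    1 - a < -(a * Real.logb 2 a) - (1 - a) * Real.logb 2 (1 - a) := by
  have hhalf : Real.logb 2 (1 / 2) = -1 := by
    rw [one_div, Real.logb_inv, Real.logb_self_eq_one one_lt_two]
  rcases le_total a (1 / 2) with h | h
  · have h1 : Real.logb 2 a ≤ -1 := hhalf ▸ Real.logb_le_logb_of_le one_lt_two (by linarith) h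
    have h2 : Real.logb 2 (1 - a) ≤ -(4 / 3 * a) := by
      have hlog := Real.log_le_sub_one_of_pos (show 0 < 1 - a by linarith)
      rw [Real.logb, div_le_iff₀ (Real.log_pos one_lt_two)]
      nlinarith [Real.log_two_lt_d9]
    nlinarith [mul_le_mul_of_nonneg_left h2 (show 0 ≤ 1 - a by linarith)]
  · have h1 : Real.logb 2 a < 0 := Real.logb_neg one_lt_two (by linarith) ha1
    have h2 : Real.logb 2 (1 - a) ≤ -1 :=
      hhalf ▸ Real.logb_le_logb_of_le one_lt_two (by linarith) (by linarith)
    nlinarith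

/-- Prefixing a separate codeword `[true]` for `a` to a code for the remaining indices. -/
lemma PrefixFreeOn.update_cons {ι : Type*} [DecidableEq ι] {s : Finset ι} {a : ι}
    {c : ι → List Bool} (hc : PrefixFreeOn (s.erase a) c) :
    PrefixFreeOn s (Function.update (fun i => false :: c i) a [true]) := by
  intro i hi j hj hij
  by_cases hia : i = a
  · subst hia
    simp [Function.update_of_ne hij.symm]
  by_cases hja : j = a
  · subst hja
    simp [Function.update_of_ne hij]
  · rw [Function.update_of_ne hia, Function.update_of_ne hja]
    simpa using hc i (Finset.mem_erase.2 ⟨hia, hi⟩) j (Finset.mem_erase.2 ⟨hja, hj⟩) hij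

/-- Every positive probability vector has a prefix-free terminating-yes code of average length at
most its entropy plus one, strictly so if there are at least two symbols. -/
lemma exists_termYes_code {ι : Type*} (s : Finset ι) :
    ∀ p : ι → ℝ, (∀ i ∈ s, 0 < p i) → ∑ i ∈ s, p i = 1 →
      ∃ c : ι → List Bool, PrefixFreeOn s c ∧ (∀ i ∈ s, (c i).getLast? = some true) ∧
        ∑ i ∈ s, p i * ((c i).length : ℝ) ≤ -∑ i ∈ s, p i * Real.logb 2 (p i) + 1 ∧
        (1 < s.card →
          ∑ i ∈ s, p i * ((c i).length : ℝ) < -∑ i ∈ s, p i * Real.logb 2 (p i) + 1) := by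
  classical
  induction s using Finset.strongInduction with
  | H s ih =>
  intro p hp hsum
  by_cases hlarge : ∃ a ∈ s, 3 / 8 < p a
  · obtain ⟨a, ha, hpa⟩ := hlarge
    have hrest : p a + ∑ i ∈ s.erase a, p i = 1 := by rw [Finset.add_sum_erase s p ha, hsum]
    rcases (s.erase a).eq_empty_or_nonempty with he | hne
    · have hsa : s = {a} := by rw [← Finset.insert_erase ha, he]; rfl
      subst hsa
      have hpa1 : p a = 1 := by simpa using hsum
      refine ⟨fun _ => [true], ?_, ?_, ?_, ?_⟩ <;> simp [PrefixFreeOn, hpa1]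
    · have hpos : 0 < ∑ i ∈ s.erase a, p i :=
        Finset.sum_pos (fun i hi => hp i (Finset.mem_of_mem_erase hi)) hne
      have hQ : ∑ i ∈ s.erase a, p i = 1 - p a := by linarith
      have hQ0 : 0 < 1 - p a := hQ ▸ hpos
      obtain ⟨c, hc, hlast, hle, -⟩ := ih (s.erase a) (Finset.erase_ssubset ha)
        (fun i => p i / (1 - p a)) (fun i hi => div_pos (hp i (Finset.mem_of_mem_erase hi)) hQ0)
        (by rw [← Finset.sum_div, hQ, div_self hQ0.ne'])
      have hscaled : ∑ i ∈ s.erase a, p i * ((c i).length : ℝ) ≤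
          -∑ i ∈ s.erase a, p i * Real.logb 2 (p i) + (1 - p a) * Real.logb 2 (1 - p a)
            + (1 - p a) := by
        have h1 : ∑ i ∈ s.erase a, p i / (1 - p a) * ((c i).length : ℝ) =
            (∑ i ∈ s.erase a, p i * ((c i).length : ℝ)) / (1 - p a) := by
          rw [Finset.sum_div]
          exact Finset.sum_congr rfl fun i _ => by ring
        have h2 : ∑ i ∈ s.erase a, p i / (1 - p a) * Real.logb 2 (p i / (1 - p a)) =
            (∑ i ∈ s.erase a, p i * Real.logb 2 (p i) - (1 - p a) * Real.logb 2 (1 - p a))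
              / (1 - p a) := by
          rw [show (1 - p a) * Real.logb 2 (1 - p a) =
            ∑ i ∈ s.erase a, p i * Real.logb 2 (1 - p a) by rw [← Finset.sum_mul, hQ], ← Finset.sum_sub_distrib, Finset.sum_div]
          refine Finset.sum_congr rfl fun i hi => ?_
          rw [Real.logb_div (hp i (Finset.mem_of_mem_erase hi)).ne' hQ0.ne']
          ring
        rw [h1, h2, div_le_iff₀ hQ0, add_mul, neg_mul, div_mul_cancel₀ _ hQ0.ne'] at hle
        linarith
      have hlen : ∑ i ∈ s, p i *
          ((Function.update (fun i => false :: c i) a [true] i).length : ℝ) =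
            1 + ∑ i ∈ s.erase a, p i * ((c i).length : ℝ) := by
        rw [← Finset.add_sum_erase s _ ha, Function.update_self, ← hrest, add_assoc,
          ← Finset.sum_add_distrib]
        congr 1
        · simp
        · refine Finset.sum_congr rfl fun i hi => ?_
          rw [Function.update_of_ne (Finset.ne_of_mem_erase hi)]
          simp only [List.length_cons]
          push_cast
          ring
      have hlt := one_sub_lt_entropy_of_large hpa (by linarith)
      have hent := Finset.add_sum_erase s (fun i => p i * Real.logb 2 (p i)) ha
      have hmain : ∑ i ∈ s, p i *
          ((Function.update (fun i => false :: c i) a [true] i).length : ℝ) <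
            -∑ i ∈ s, p i * Real.logb 2 (p i) + 1 := by
        rw [hlen]
        linarith
      refine ⟨_, hc.update_cons, fun i hi => ?_, hmain.le, fun _ => hmain⟩
      by_cases hia : i = a
      · simp [hia]
      · rw [Function.update_of_ne hia, List.getLast?_cons,
          hlast i (Finset.mem_erase.2 ⟨hia, hi⟩)]
        rfl
  · push Not at hlarge
    obtain ⟨l, hkraft, hl⟩ := exists_lengths_redundancy_lt_half hp hsum hlarge
    obtain ⟨c, hc, hcl⟩ := exists_prefixFreeOn_of_kraft l s hkraft
    have hne : ∀ i ∈ s, c i ≠ [] := by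
      intro i hi hnil
      have hsi : ∀ j ∈ s, j = i := by
        intro j hj
        by_contra hji
        exact hc i hi j hj (Ne.symm hji) (hnil ▸ List.nil_prefix)
      have : ∑ j ∈ s, p j = p i :=
        Finset.sum_eq_single_of_mem i hi fun j hj hji => absurd (hsi j hj) hji
      linarith [hlarge i hi]
    obtain ⟨c', hc', hlast, hle⟩ := exists_termYes_of_prefixFreeOn hsum hc hne
    have hcl' : ∑ i ∈ s, p i * ((c i).length : ℝ) = ∑ i ∈ s, p i * (l i : ℝ) :=
      Finset.sum_congr rfl fun i hi => by rw [hcl i hi]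
    simp only [mul_add, Finset.sum_add_distrib] at hl
    have hmain : ∑ i ∈ s, p i * ((c' i).length : ℝ) <
        -∑ i ∈ s, p i * Real.logb 2 (p i) + 1 := by linarith
    exact ⟨c', hc', hlast, hmain.le, fun _ => hmain⟩

/-- Upper bound: the optimal terminating-yes average length is strictly below
`H(p) + 1`; in particular some prefix-free terminating-yes code has average
length strictly less than the entropy plus one. -/
theorem Lyes_lt_entropy_add_one (n : ℕ) (hn : 2 ≤ n) (p : Fin n → ℝ)
    (hp : IsProbVec p) (hpos : ∀ i, 0 < p i) :
    Lyes p < entropy p + 1 ∧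
    ∃ c : Fin n → List Bool, IsPrefixFreeCode c ∧ IsTermYes c ∧
      avgLen p c < entropy p + 1 := by
  obtain ⟨c, hc, hlast, -, hlt⟩ := exists_termYes_code Finset.univ p (fun i _ => hpos i) hp.2
  have hlt : avgLen p c < entropy p + 1 := hlt (by simpa using Nat.lt_of_succ_le hn)
  have hpf : IsPrefixFreeCode c := by
    have hnot : ∀ i j : Fin n, i ≠ j → ¬ (c i <+: c j) := fun i j =>
      hc i (Finset.mem_univ i) j (Finset.mem_univ j)
    refine ⟨fun i j hij => ?_, hnot⟩
    by_contra hne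
    exact hnot i j hne (hij ▸ List.prefix_rfl)
  have hyes : IsTermYes c := fun i => by
    have := hlast i (Finset.mem_univ i)
    refine ⟨fun hnil => ?_, this⟩
    simp [hnil] at this
  refine ⟨lt_of_le_of_lt (csInf_le ⟨0, ?_⟩ ⟨c, hpf, hyes, rfl⟩) hlt, c, hpf, hyes, hlt⟩
  rintro _ ⟨d, -, -, rfl⟩
  exact Finset.sum_nonneg fun i _ => mul_nonneg (hp.1 i) (Nat.cast_nonneg _)
end

section
/- Let n ≥ 2 and let p : Fin n → ℝ be a probability vector with p i > 0 for all i. Then the chain of inequalities H(p) ≤ L_H(p) < L_yes(p) < H(p) + 1 holds. -/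
lemma isPrefix_total_of_isPrefix {α : Type*} {u v w : List α} (hu : u <+: w) (hv : v <+: w) :
    u <+: v ∨ v <+: u :=
  (le_total u.length v.length).imp (List.prefix_of_prefix_length_le hu hv)
    (List.prefix_of_prefix_length_le hv hu)

/-- The finset of all binary words of length `L`. -/
def binaryWords (L : ℕ) : Finset (List Bool) :=
  (Finset.univ : Finset (List.Vector Bool L)).map ⟨List.Vector.toList, List.Vector.toList_injective⟩

lemma mem_binaryWords {L : ℕ} {w : List Bool} : w ∈ binaryWords L ↔ w.length = L := by
  simp only [binaryWords, Finset.mem_map, Finset.mem_univ, true_and, Function.Embedding.coeFn_mk]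
  exact ⟨fun ⟨v, hv⟩ => hv ▸ v.toList_length, fun h => ⟨⟨w, h⟩, rfl⟩⟩

lemma card_binaryWords (L : ℕ) : (binaryWords L).card = 2 ^ L := by
  simp [binaryWords, card_vector]

/-- A set of words of length `L` that is larger than the number of words of length `L` extending
one of the given words contains a word extending none of them. -/
lemma exists_mem_forall_not_isPrefix {ι : Type*} (s : Finset ι) (u : ι → List Bool) (L : ℕ)
    (A : Finset (List Bool)) (hA : ∀ w ∈ A, w.length = L) (hu : ∀ j ∈ s, (u j).length ≤ L)
    (h : (2 : ℝ) ^ L * ∑ j ∈ s, (1 / 2 : ℝ) ^ (u j).length < A.card) :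
    ∃ w ∈ A, ∀ j ∈ s, ¬ u j <+: w := by
  by_contra! hcon
  have hsub : A ⊆ s.biUnion fun j => (binaryWords (L - (u j).length)).image (u j ++ ·) := by
    intro w hw
    obtain ⟨j, hj, t, rfl⟩ := hcon w hw
    have hlen := hA _ hw
    rw [List.length_append] at hlen
    simp only [Finset.mem_biUnion, Finset.mem_image]
    exact ⟨j, hj, t, mem_binaryWords.2 (by omega), rfl⟩
  have hcard : A.card ≤ ∑ j ∈ s, 2 ^ (L - (u j).length) := by
    refine (Finset.card_le_card hsub).trans (Finset.card_biUnion_le.trans ?_)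
    refine Finset.sum_le_sum fun j _ => Finset.card_image_le.trans ?_
    rw [card_binaryWords]
  have hsum : ((∑ j ∈ s, 2 ^ (L - (u j).length) : ℕ) : ℝ)
      = (2 : ℝ) ^ L * ∑ j ∈ s, (1 / 2 : ℝ) ^ (u j).length := by
    push_cast
    rw [Finset.mul_sum]
    refine Finset.sum_congr rfl fun j hj => ?_
    rw [pow_sub₀ _ two_ne_zero (hu j hj), one_div, inv_pow]
  rw [← hsum] at h
  exact absurd (by exact_mod_cast h) hcard.not_gt

/-- Given positive lengths satisfying Kraft's inequality there is a prefix-free family of words of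
these lengths in which the words that may fail to end with `true` are either absent or have
total dyadic mass at most the Kraft sum minus `1 / 2`. -/
lemma exists_prefixFree_family {ι : Type*} [DecidableEq ι] (l : ι → ℕ) (s : Finset ι)
    (hl : ∀ i, 1 ≤ l i) (hs : ∑ i ∈ s, (1 / 2 : ℝ) ^ l i ≤ 1) :
    ∃ (u : ι → List Bool) (E : Finset ι), E ⊆ s ∧ (∀ i ∈ s, (u i).length = l i) ∧
      (∀ i ∈ s, ∀ j ∈ s, i ≠ j → ¬ u i <+: u j) ∧
      (∀ i ∈ s, i ∉ E → (u i).getLast? = some true) ∧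
      (E = ∅ ∨ ∑ i ∈ E, (1 / 2 : ℝ) ^ l i ≤ ∑ i ∈ s, (1 / 2 : ℝ) ^ l i - 1 / 2) := by
  induction s using Finset.induction_on_max_value l with
  | empty => exact ⟨fun _ => [], ∅, by simp⟩
  | insert a s ha hmax ih =>
    rw [Finset.sum_insert ha] at hs
    have hq : (0 : ℝ) < (1 / 2 : ℝ) ^ l a := by positivity
    obtain ⟨u, E, hE, hlen, hpf, hlast, hmass⟩ := ih (by linarith)
    have hsum : ∑ j ∈ s, (1 / 2 : ℝ) ^ (u j).length = ∑ j ∈ s, (1 / 2 : ℝ) ^ l j :=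
      Finset.sum_congr rfl fun j hj => by rw [hlen j hj]
    have hu : ∀ j ∈ s, (u j).length ≤ l a := fun j hj => (hlen j hj).trans_le (hmax j hj)
    have hne : ∀ j ∈ s, j ≠ a := fun j hj h => ha (h ▸ hj)
    have extend : ∀ w : List Bool, w.length = l a → (∀ j ∈ s, ¬ u j <+: w) →
        (∀ i ∈ insert a s, (Function.update u a w i).length = l i) ∧
        (∀ i ∈ insert a s, ∀ j ∈ insert a s, i ≠ j →
          ¬ Function.update u a w i <+: Function.update u a w j) := by
      intro w hw hav
      constructor
      · intro i hi
        rcases Finset.mem_insert.1 hi with rfl | hi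
        · simpa using hw
        · simpa [hne i hi] using hlen i hi
      · intro i hi j hj hij
        rcases Finset.mem_insert.1 hi with rfl | his <;> rcases Finset.mem_insert.1 hj with rfl | hjs
        · exact absurd rfl hij
        · simp only [Function.update_self, Function.update_of_ne (hne j hjs)]
          intro hpre
          have : w = u j := hpre.eq_of_length_le (hw ▸ hu j hjs)
          exact hav j hjs (this ▸ List.prefix_rfl)
        · simpa [hne i his] using hav i his
        · simpa [hne i his, hne j hjs] using hpf i his j hjs hij
    by_cases hK : ∑ j ∈ s, (1 / 2 : ℝ) ^ l j < 1 / 2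
    · obtain ⟨w, hwA, hav⟩ := exists_mem_forall_not_isPrefix s u (l a)
        ((binaryWords (l a - 1)).image (· ++ [true]))
        (by
          intro w hw
          obtain ⟨v, hv, rfl⟩ := Finset.mem_image.1 hw
          have := mem_binaryWords.1 hv
          have := hl a
          simp
          omega) hu (by
          rw [Finset.card_image_of_injective _ (List.append_left_injective _), card_binaryWords,
            hsum]
          obtain ⟨k, hk⟩ := Nat.exists_eq_add_of_le' (hl a)
          rw [hk]
          have : (0 : ℝ) < 2 ^ k := by positivity
          push_cast
          rw [pow_succ]
          nlinarith)
      obtain ⟨v, hv, rfl⟩ := Finset.mem_image.1 hwA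
      have hva : (v ++ [true]).length = l a := by
        have := mem_binaryWords.1 hv
        have := hl a
        simp
        omega
      obtain ⟨h₁, h₂⟩ := extend _ hva hav
      refine ⟨_, E, hE.trans (Finset.subset_insert _ _), h₁, h₂, ?_, ?_⟩
      · intro i hi hiE
        rcases Finset.mem_insert.1 hi with rfl | hi
        · simp
        · simpa [hne i hi] using hlast i hi hiE
      · rw [Finset.sum_insert ha]
        exact hmass.imp_right fun h => by linarith
    · obtain ⟨w, hwA, hav⟩ := exists_mem_forall_not_isPrefix s u (l a) (binaryWords (l a))
        (fun w hw => mem_binaryWords.1 hw) hu (by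
          rw [card_binaryWords, hsum]
          have : (0 : ℝ) < 2 ^ l a := by positivity
          push_cast
          nlinarith)
      obtain ⟨h₁, h₂⟩ := extend _ (mem_binaryWords.1 hwA) hav
      refine ⟨_, insert a E, Finset.insert_subset_insert _ hE, h₁, h₂, ?_, Or.inr ?_⟩
      · intro i hi hiE
        rcases Finset.mem_insert.1 hi with rfl | hi
        · simp at hiE
        · simpa [hne i hi] using hlast i hi fun h => hiE (Finset.mem_insert_of_mem h)
      · rw [Finset.sum_insert ha, Finset.sum_insert fun h => ha (hE h)]
        rcases hmass with rfl | h
        · simp only [Finset.sum_empty]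
          linarith
        · linarith

/-- A family of pairwise prefix-incomparable words gives a terminating-yes code by appending `true`
to the words that do not already end with it. -/
lemma exists_termYes_code_s10 {n : ℕ} (l : Fin n → ℕ) (hl : ∀ i, 1 ≤ l i)
    (hs : ∑ i, (1 / 2 : ℝ) ^ l i ≤ 1) :
    ∃ (c : Fin n → List Bool) (E : Finset (Fin n)), IsPrefixFreeCode c ∧ IsTermYes c ∧
      (∀ i, (c i).length = l i + if i ∈ E then 1 else 0) ∧
      (E = ∅ ∨ ∑ i ∈ E, (1 / 2 : ℝ) ^ l i ≤ ∑ i, (1 / 2 : ℝ) ^ l i - 1 / 2) := by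
  obtain ⟨u, E, -, hlen, hpf, hlast, hmass⟩ := exists_prefixFree_family l Finset.univ hl hs
  let c : Fin n → List Bool := fun i => if i ∈ E then u i ++ [true] else u i
  have huc : ∀ i, u i <+: c i := fun i => by
    by_cases hi : i ∈ E <;> simp [c, hi]
  have hcpf : ∀ i j, i ≠ j → ¬ c i <+: c j := fun i j hij h =>
    (isPrefix_total_of_isPrefix ((huc i).trans h) (huc j)).elim
      (hpf i (Finset.mem_univ i) j (Finset.mem_univ j) hij)
      (hpf j (Finset.mem_univ j) i (Finset.mem_univ i) hij.symm)
  have hyes : ∀ i, (c i).getLast? = some true := fun i => by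
    by_cases hi : i ∈ E
    · simp [c, hi]
    · simpa [c, hi] using hlast i (Finset.mem_univ i) hi
  refine ⟨c, E, ⟨fun i j hij => ?_, hcpf⟩, fun i => ⟨fun h => ?_, hyes i⟩, fun i => ?_, hmass⟩
  · by_contra hne
    exact hcpf i j hne (hij ▸ List.prefix_rfl)
  · simpa [h] using hyes i
  · have := hlen i (Finset.mem_univ i)
    by_cases hi : i ∈ E <;> simp [c, hi, this]

lemma IsPrefixFreeCode.ne_nil {n : ℕ} (hn : 2 ≤ n) {c : Fin n → List Bool}
    (hc : IsPrefixFreeCode c) (i : Fin n) : c i ≠ [] := by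
  intro h
  have : Nontrivial (Fin n) := Fin.nontrivial_iff_two_le.2 hn
  obtain ⟨j, hj⟩ := exists_ne i
  exact hc.2 i j hj.symm ⟨c j, by rw [h, List.nil_append]⟩

lemma IsPrefixFreeCode.uniquelyDecodable {n : ℕ} (hn : 2 ≤ n) {c : Fin n → List Bool}
    (hc : IsPrefixFreeCode c) : InformationTheory.UniquelyDecodable (Set.range c) := by
  intro L₁
  induction L₁ with
  | nil =>
    rintro (_ | ⟨w, L₂⟩) _ h₂ h
    · rfl
    · obtain ⟨i, rfl⟩ := h₂ w (by simp)
      simp [hc.ne_nil hn i] at h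
  | cons v L₁ ih =>
    rintro (_ | ⟨w, L₂⟩) h₁ h₂ h
    · obtain ⟨i, rfl⟩ := h₁ v (by simp)
      simp [hc.ne_nil hn i] at h
    · obtain ⟨i, rfl⟩ := h₁ v (by simp)
      obtain ⟨j, rfl⟩ := h₂ w (by simp)
      rw [List.flatten_cons, List.flatten_cons] at h
      have hij : i = j := by
        by_contra hij
        exact (isPrefix_total_of_isPrefix (List.prefix_append (c i) L₁.flatten)
          (h ▸ List.prefix_append (c j) L₂.flatten)).elim (hc.2 i j hij) (hc.2 j i (Ne.symm hij))
      subst hij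
      rw [ih L₂ (fun w hw => h₁ w (List.mem_cons_of_mem _ hw))
        (fun w hw => h₂ w (List.mem_cons_of_mem _ hw)) (List.append_cancel_left h)]

lemma IsPrefixFreeCode.kraft {n : ℕ} (hn : 2 ≤ n) {c : Fin n → List Bool}
    (hc : IsPrefixFreeCode c) : ∑ i, (1 / 2 : ℝ) ^ (c i).length ≤ 1 := by
  have h := InformationTheory.kraft_mcmillan_inequality (S := Finset.univ.image c)
    (by simpa using hc.uniquelyDecodable hn)
  rw [Finset.sum_image fun i _ j _ hij => hc.1 hij] at h
  simpa using h

/-- Gibbs' inequality for a subprobability vector of dyadic weights. -/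
lemma entropy_le_sum_mul_of_kraft {n : ℕ} {p : Fin n → ℝ} (hp : IsProbVec p) (hpos : ∀ i, 0 < p i)
    (l : Fin n → ℕ) (hl : ∑ i, (1 / 2 : ℝ) ^ l i ≤ 1) : entropy p ≤ ∑ i, p i * (l i : ℝ) := by
  have hlog : 0 < Real.log 2 := Real.log_pos one_lt_two
  have key : ∀ i, -(p i * Real.logb 2 (p i)) - p i * (l i : ℝ)
      ≤ ((1 / 2 : ℝ) ^ l i - p i) / Real.log 2 := by
    intro i
    have hq : (0 : ℝ) < (1 / 2 : ℝ) ^ l i := by positivity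
    have h := Real.log_le_sub_one_of_pos (div_pos hq (hpos i))
    rw [Real.log_div hq.ne' (hpos i).ne', Real.log_pow, one_div, Real.log_inv] at h
    have h' := mul_le_mul_of_nonneg_left h (hpos i).le
    rw [mul_sub (p i) (_ / _), mul_div_cancel₀ _ (hpos i).ne'] at h'
    rw [le_div_iff₀ hlog, Real.logb]
    field_simp
    field_simp at h'
    linarith
  have hsum := Finset.sum_le_sum fun i (_ : i ∈ Finset.univ) => key i
  rw [← Finset.sum_div, Finset.sum_sub_distrib, Finset.sum_sub_distrib, Finset.sum_neg_distrib,
    hp.2] at hsum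
  have : (∑ i, (1 / 2 : ℝ) ^ l i - 1) / Real.log 2 ≤ 0 :=
    div_nonpos_of_nonpos_of_nonneg (by linarith) hlog.le
  unfold entropy
  linarith

/-- Deleting the final `true` of a longest codeword keeps a terminating-yes code prefix-free. -/
lemma exists_prefixFree_shorter {n : ℕ} [NeZero n] {c : Fin n → List Bool}
    (hc : IsPrefixFreeCode c) (hy : IsTermYes c) (p : Fin n → ℝ) :
    ∃ (c' : Fin n → List Bool) (i : Fin n), IsPrefixFreeCode c' ∧
      avgLen p c' = avgLen p c - p i := by
  obtain ⟨i, hi⟩ := Finite.exists_max fun i => (c i).length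
  obtain ⟨u, hu⟩ : ∃ u, c i = u ++ [true] := by
    obtain ⟨u, hu⟩ := List.getLast?_eq_some_iff.1 (hy i).2
    exact ⟨u, hu⟩
  have hui : u <+: c i := hu ▸ List.prefix_append _ _
  have h_not : ∀ j, j ≠ i → ¬ c j <+: u ∧ ¬ u <+: c j := by
    intro j hj
    refine ⟨fun h => hc.2 j i hj (h.trans hui), ?_⟩
    rintro ⟨t, ht⟩
    have hlen := hi j
    rw [hu, ← ht] at hlen
    simp only [List.length_append, List.length_singleton, Nat.add_le_add_iff_left] at hlen
    have hlast := (hy j).2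
    match t, hlen with
    | [], _ =>
      rw [List.append_nil] at ht
      exact hc.2 j i hj (ht ▸ hui)
    | [b], _ =>
      rw [← ht] at hlast
      simp at hlast
      subst hlast
      exact hj (hc.1 (ht.symm.trans hu.symm))
  have hpf : ∀ j k, j ≠ k → ¬ Function.update c i u j <+: Function.update c i u k := by
    intro j k hjk
    by_cases hj : j = i
    · subst hj
      simpa [hjk.symm] using (h_not k hjk.symm).2
    · by_cases hk : k = i
      · subst hk
        simpa [hjk] using (h_not j hjk).1
      · simpa [hj, hk] using hc.2 j k hjk
  refine ⟨Function.update c i u, i, ⟨fun j k hjk => ?_, hpf⟩, ?_⟩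
  · by_contra hne
    exact hpf j k hne (hjk ▸ List.prefix_rfl)
  · unfold avgLen
    rw [← Finset.add_sum_erase _ _ (Finset.mem_univ i),
      ← Finset.add_sum_erase (a := i) Finset.univ (fun i => p i * ((c i).length : ℝ))
        (Finset.mem_univ i)]
    rw [Finset.sum_congr rfl fun j hj => by
      rw [Function.update_of_ne (Finset.ne_of_mem_erase hj)]]
    simp only [Function.update_self, hu, List.length_append, List.length_singleton]
    push_cast
    ring

lemma avgLen_nonneg {n : ℕ} {p : Fin n → ℝ} (hp : IsProbVec p) (c : Fin n → List Bool) :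
    0 ≤ avgLen p c :=
  Finset.sum_nonneg fun i _ => mul_nonneg (hp.1 i) (Nat.cast_nonneg _)

lemma LH_le_avgLen {n : ℕ} {p : Fin n → ℝ} (hp : IsProbVec p) {c : Fin n → List Bool}
    (hc : IsPrefixFreeCode c) : LH p ≤ avgLen p c :=
  csInf_le ⟨0, by rintro _ ⟨c, -, rfl⟩; exact avgLen_nonneg hp c⟩ ⟨c, hc, rfl⟩

lemma Lyes_le_avgLen {n : ℕ} {p : Fin n → ℝ} (hp : IsProbVec p) {c : Fin n → List Bool}
    (hc : IsPrefixFreeCode c) (hy : IsTermYes c) : Lyes p ≤ avgLen p c :=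
  csInf_le ⟨0, by rintro _ ⟨c, -, -, rfl⟩; exact avgLen_nonneg hp c⟩ ⟨c, hc, hy, rfl⟩

/-- Lengthening Shannon's code lengths by one on a suitable set of symbols gives a terminating-yes
code whose average length exceeds the entropy by less than one bit. -/
lemma exists_termYes_avgLen_lt {n : ℕ} (hn : 2 ≤ n) {p : Fin n → ℝ} (hp : IsProbVec p)
    (hpos : ∀ i, 0 < p i) :
    ∃ c : Fin n → List Bool, IsPrefixFreeCode c ∧ IsTermYes c ∧ avgLen p c < entropy p + 1 := by
  have : Nontrivial (Fin n) := Fin.nontrivial_iff_two_le.2 hn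
  have hlt : ∀ i, p i < 1 := by
    intro i
    obtain ⟨j, hj⟩ := exists_ne i
    have h := Finset.add_le_sum (fun k _ => hp.1 k) (Finset.mem_univ i) (Finset.mem_univ j) hj.symm
    rw [hp.2] at h
    linarith [hpos j]
  let y : Fin n → ℝ := fun i => -Real.logb 2 (p i)
  let l : Fin n → ℕ := fun i => ⌈y i⌉₊
  have hy : ∀ i, 0 < y i := fun i => by
    simpa [y] using Real.logb_neg one_lt_two (hpos i) (hlt i)
  have hl : ∀ i, 1 ≤ l i := fun i => Nat.ceil_pos.2 (hy i)
  have hyl : ∀ i, y i ≤ l i := fun i => Nat.le_ceil _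
  have hly : ∀ i, (l i : ℝ) < y i + 1 := fun i => Nat.ceil_lt_add_one (hy i).le
  have hpy : ∀ i, p i = (1 / 2 : ℝ) ^ y i := fun i => by
    simp only [y]
    rw [one_div, Real.inv_rpow zero_le_two, Real.rpow_neg zero_le_two, inv_inv,
      Real.rpow_logb two_pos (by norm_num) (hpos i)]
  have hq : ∀ i, (1 / 2 : ℝ) ^ l i = p i * (1 / 2 : ℝ) ^ ((l i : ℝ) - y i) := fun i => by
    rw [hpy i, ← Real.rpow_add (by norm_num), add_sub_cancel, Real.rpow_natCast]
  have hqle : ∀ i, (1 / 2 : ℝ) ^ l i ≤ p i * (1 - ((l i : ℝ) - y i) / 2) := fun i => by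
    rw [hq i]
    refine mul_le_mul_of_nonneg_left ?_ (hpos i).le
    have h := rpow_one_add_le_one_add_mul_self (s := -1 / 2) (by norm_num)
      (sub_nonneg.2 (hyl i)) (by linarith [hly i])
    norm_num at h ⊢
    linarith
  have hltq : ∀ i, p i < 2 * (1 / 2 : ℝ) ^ l i := fun i => by
    have h : (1 / 2 : ℝ) ^ (1 : ℝ) < (1 / 2 : ℝ) ^ ((l i : ℝ) - y i) :=
      Real.rpow_lt_rpow_of_exponent_gt (by norm_num) (by norm_num) (by linarith [hly i])
    rw [Real.rpow_one] at h
    rw [hq i]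
    nlinarith [hpos i]
  have hkraft : ∑ i, (1 / 2 : ℝ) ^ l i ≤ 1 := by
    refine (Finset.sum_le_sum fun i _ => (hqle i).trans ?_).trans_eq hp.2
    nlinarith [hpos i, hyl i]
  have hH : entropy p = ∑ i, p i * y i := by
    simp [entropy, y]
  obtain ⟨c, E, hc, hyes, hlen, hmass⟩ := exists_termYes_code_s10 l hl hkraft
  refine ⟨c, hc, hyes, ?_⟩
  have havg : avgLen p c = ∑ i, p i * (l i : ℝ) + ∑ i ∈ E, p i := by
    simp only [avgLen, hlen]
    push_cast
    simp [mul_add, Finset.sum_add_distrib]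
  have hH1 : entropy p + 1 = ∑ i, p i * (y i + 1) := by
    simp [mul_add, Finset.sum_add_distrib, hH, hp.2]
  rcases E.eq_empty_or_nonempty with rfl | hE
  · rw [havg, hH1, Finset.sum_empty, add_zero]
    exact Finset.sum_lt_sum_of_nonempty Finset.univ_nonempty fun i _ =>
      mul_lt_mul_of_pos_left (hly i) (hpos i)
  · have hEmass := hmass.resolve_left hE.ne_empty
    have h₁ : ∑ i ∈ E, p i < 2 * ∑ i ∈ E, (1 / 2 : ℝ) ^ l i := by
      rw [Finset.mul_sum]
      exact Finset.sum_lt_sum_of_nonempty hE fun i _ => hltq i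
    have h₂ : ∑ i, (2 * (1 / 2 : ℝ) ^ l i - p i) ≤ ∑ i, (p i * (y i + 1) - p i * (l i : ℝ)) :=
      Finset.sum_le_sum fun i _ => by linarith [hqle i]
    rw [Finset.sum_sub_distrib, Finset.sum_sub_distrib, ← Finset.mul_sum, hp.2, ← hH1] at h₂
    linarith

/-- Main theorem: `H(p) ≤ L_H(p) < L_yes(p) < H(p) + 1`. -/
theorem entropy_le_LH_lt_Lyes_lt_entropy_add_one (n : ℕ) (hn : 2 ≤ n)
    (p : Fin n → ℝ) (hp : IsProbVec p) (hpos : ∀ i, 0 < p i) :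
    entropy p ≤ LH p ∧ LH p < Lyes p ∧ Lyes p < entropy p + 1 := by
  have : NeZero n := ⟨by omega⟩
  obtain ⟨c, hc, hy, hlt⟩ := exists_termYes_avgLen_lt hn hp hpos
  refine ⟨?_, ?_, (Lyes_le_avgLen hp hc hy).trans_lt hlt⟩
  · refine le_csInf ⟨_, c, hc, rfl⟩ ?_
    rintro _ ⟨d, hd, rfl⟩
    exact entropy_le_sum_mul_of_kraft hp hpos _ (hd.kraft hn)
  · obtain ⟨k, hk⟩ := Finite.exists_min p
    have hle : LH p + p k ≤ Lyes p := by
      refine le_csInf ⟨_, c, hc, hy, rfl⟩ ?_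
      rintro _ ⟨d, hd, hdy, rfl⟩
      obtain ⟨d', i, hd', havg⟩ := exists_prefixFree_shorter hd hdy p
      linarith [LH_le_avgLen hp hd', hk i]
    linarith [hpos k]
end

section
/- For every real p with 0.4 ≤ p ≤ 1, one has H₂(p) + p ≥ 1, equivalently 2 − (H₂(p) + p) ≤ 1, where H₂(p) = −p·log₂ p − (1−p)·log₂(1−p) is the binary entropy function (with the convention 0·log₂ 0 = 0). Equality holds at p = 1. -/
/-- The binary entropy function `H₂(p) = -p log₂ p - (1-p) log₂ (1-p)`
(the convention `0 · log₂ 0 = 0` is automatic since `Real.logb 2 0 = 0`). -/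
noncomputable def binEnt (p : ℝ) : ℝ :=
  -p * Real.logb 2 p - (1 - p) * Real.logb 2 (1 - p)

theorem binEnt_eq_binEntropy_div (p : ℝ) : binEnt p = Real.binEntropy p / Real.log 2 := by
  simp only [binEnt, Real.logb, Real.binEntropy, Real.log_inv]
  ring

theorem three_fourths_mul_log_two_le_binEntropy :
    3 / 4 * Real.log 2 ≤ Real.binEntropy (1 / 4) := by
  have h₄ : Real.log 4 = 2 * Real.log 2 := by
    rw [show (4 : ℝ) = 2 ^ 2 by norm_num, Real.log_pow]
    norm_num
  have h₃ : 3 * Real.log 3 ≤ 5 * Real.log 2 := by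
    have h : Real.log ((3 : ℝ) ^ 3) ≤ Real.log ((2 : ℝ) ^ 5) :=
      Real.log_le_log (by norm_num) (by norm_num)
    simpa only [Real.log_pow, Nat.cast_ofNat] using h
  have h : Real.binEntropy (1 / 4) = 2 * Real.log 2 - 3 / 4 * Real.log 3 := by
    rw [Real.binEntropy, show (1 / 4 : ℝ)⁻¹ = 4 by norm_num,
      show (1 - 1 / 4 : ℝ)⁻¹ = 4 / 3 by norm_num, Real.log_div (by norm_num) (by norm_num), h₄]
    ring
  linarith

/-- On `[1/4, 1]` the concave binary entropy lies above the chord through `(1, 0)`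
and `(1/4, 3/4 * log 2)`. -/
theorem one_sub_mul_log_two_le_binEntropy {p : ℝ} (hp : 1 / 4 ≤ p) (hp₁ : p ≤ 1) :
    (1 - p) * Real.log 2 ≤ Real.binEntropy p := by
  have h := Real.strictConcave_binEntropy.concaveOn.2
    (show (1 / 4 : ℝ) ∈ Set.Icc 0 1 by norm_num) (show (1 : ℝ) ∈ Set.Icc 0 1 by norm_num)
    (show 0 ≤ 4 / 3 * (1 - p) by linarith) (show 0 ≤ 1 - 4 / 3 * (1 - p) by linarith) (by ring)
  simp only [smul_eq_mul, Real.binEntropy_one, mul_zero, add_zero] at h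
  rw [show 4 / 3 * (1 - p) * (1 / 4) + (1 - 4 / 3 * (1 - p)) * 1 = p by ring] at h
  have hm := mul_le_mul_of_nonneg_left three_fourths_mul_log_two_le_binEntropy
    (show 0 ≤ 4 / 3 * (1 - p) by linarith)
  linarith

/-- For `0.4 ≤ p ≤ 1` one has `H₂(p) + p ≥ 1`, equivalently
`2 - (H₂(p) + p) ≤ 1`, with equality at `p = 1`. -/
theorem binEnt_add_self_ge_one :
    (∀ p : ℝ, 0.4 ≤ p → p ≤ 1 →
      1 ≤ binEnt p + p ∧ 2 - (binEnt p + p) ≤ 1) ∧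
    binEnt 1 + 1 = 1 := by
  refine ⟨fun p hp hp₁ => ?_, by simp [binEnt]⟩
  have h : 1 - p ≤ binEnt p := by
    rw [binEnt_eq_binEntropy_div, le_div_iff₀ (Real.log_pos one_lt_two)]
    exact one_sub_mul_log_two_le_binEntropy (by norm_num at hp ⊢; linarith) hp₁
  constructor <;> linarith
end

section
/- The upper bound of the main theorem is tight: for every ε > 0 there exist n ≥ 2 and a probability vector p : Fin n → ℝ with p i > 0 for all i such that L_yes(p) − H(p) > 1 − ε. (For example, the two-point distribution (1−δ, δ) with δ → 0 suffices.) -/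
/-- Every average length of a terminating-yes code is at least `1`. -/
theorem one_le_avgLen {n : ℕ} {p : Fin n → ℝ} (hp : IsProbVec p) {c : Fin n → List Bool}
    (hc : IsTermYes c) : 1 ≤ avgLen p c := by
  rw [← hp.2, avgLen]
  refine Finset.sum_le_sum fun i _ => le_mul_of_one_le_right (hp.1 i) ?_
  exact_mod_cast List.length_pos_iff.mpr (hc i).1

theorem isPrefixFreeCode_true_falseTrue :
    IsPrefixFreeCode ![[true], [false, true]] := by
  unfold IsPrefixFreeCode
  decide

theorem isTermYes_true_falseTrue : IsTermYes ![[true], [false, true]] := by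
  unfold IsTermYes
  decide

theorem one_le_Lyes {p : Fin 2 → ℝ} (hp : IsProbVec p) : 1 ≤ Lyes p := by
  refine le_csInf ⟨_, _, isPrefixFreeCode_true_falseTrue, isTermYes_true_falseTrue, rfl⟩ ?_
  rintro L ⟨c, -, hc, rfl⟩
  exact one_le_avgLen hp hc

theorem entropy_two_point (x : ℝ) :
    entropy ![1 - x, x] = Real.binEntropy x / Real.log 2 := by
  simp only [entropy, Fin.sum_univ_two, Matrix.cons_val_zero, Matrix.cons_val_one,
    Real.binEntropy_eq_negMulLog_add_negMulLog_one_sub, Real.negMulLog, Real.logb]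
  ring

/-- The entropy of the two-point distribution `(1 - x, x)` vanishes as `x → 0`. -/
theorem tendsto_entropy_two_point :
    Filter.Tendsto (fun x : ℝ => entropy ![1 - x, x]) (nhds 0) (nhds 0) := by
  simp only [entropy_two_point]
  have h : Continuous fun x : ℝ => Real.binEntropy x / Real.log 2 :=
    Real.binEntropy_continuous.div_const _
  simpa using h.tendsto 0

/-- Tightness of the upper bound: the redundancy `L_yes(p) - H(p)` can be made
arbitrarily close to `1`. -/
theorem upper_bound_tight :
    ∀ ε : ℝ, 0 < ε → ∃ (n : ℕ) (p : Fin n → ℝ), 2 ≤ n ∧ IsProbVec p ∧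
      (∀ i, 0 < p i) ∧ 1 - ε < Lyes p - entropy p := by
  intro ε hε
  have hsmall : ∀ᶠ x : ℝ in nhdsWithin 0 (Set.Ioi 0), entropy ![1 - x, x] < ε :=
    (tendsto_entropy_two_point.mono_left nhdsWithin_le_nhds).eventually_lt_const hε
  obtain ⟨x, hx, hx0, hx1⟩ :=
    (hsmall.and (Ioo_mem_nhdsGT (zero_lt_one' ℝ))).exists
  have hpos : ∀ i, 0 < (![1 - x, x] : Fin 2 → ℝ) i := by
    simp [Fin.forall_fin_two, hx0, hx1]
  have hp : IsProbVec ![1 - x, x] := ⟨fun i => (hpos i).le, by simp [Fin.sum_univ_two]⟩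
  exact ⟨2, ![1 - x, x], le_rfl, hp, hpos, by linarith [one_le_Lyes hp]⟩
end
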